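/- Let n > 2 and (8 - n)/3 < α < 2. The constant (n - α)²/4 in the Rellich-type inequality on ℍⁿ is sharp: the infimum, over all nonzero φ ∈ C_c^∞(B ∖ {0}), of the quotient ( ∫_B d^α λ^{-n} (div(λ^{n-2} ∇φ))² dx ) / ( ∫_B d^{α-2} |∇φ|² λ^{n-2} dx ) equals (n - α)²/4. -/

import Mathlib

open MeasureTheory

/-- Conformal factor of the Poincaré ball model. -/
noncomputable def lam {n : ℕ} (x : EuclideanSpace ℝ (Fin n)) : ℝ := 2 / (1 - ‖x‖ ^ 2)

/-- Hyperbolic distance to the origin in the Poincaré ball model. -/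
noncomputable def dH {n : ℕ} (x : EuclideanSpace ℝ (Fin n)) : ℝ :=
  Real.log ((1 + ‖x‖) / (1 - ‖x‖))

/-- Euclidean divergence of a vector field on ℝⁿ. -/
noncomputable def dvg {n : ℕ} (V : EuclideanSpace ℝ (Fin n) → EuclideanSpace ℝ (Fin n))
    (x : EuclideanSpace ℝ (Fin n)) : ℝ :=
  ∑ i, fderiv ℝ V x (EuclideanSpace.single i 1) i

local notation "𝔼" n => EuclideanSpace ℝ (Fin n)

section Divergence

variable {n : ℕ}

lemma contDiff_of_forall_mem_tsupport {E F : Type*} [NormedAddCommGroup E] [NormedSpace ℝ E]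
    [NormedAddCommGroup F] [NormedSpace ℝ F] {m : WithTop ℕ∞} {f : E → F}
    (hf : ∀ x ∈ tsupport f, ContDiffAt ℝ m f x) : ContDiff ℝ m f := by
  refine contDiff_iff_contDiffAt.2 fun x => ?_
  by_cases hx : x ∈ tsupport f
  · exact hf x hx
  · exact contDiffAt_const.congr_of_eventuallyEq (notMem_tsupport_iff_eventuallyEq.1 hx)

lemma dvg_congr {V W : (𝔼 n) → 𝔼 n} {x : 𝔼 n} (h : V =ᶠ[nhds x] W) : dvg V x = dvg W x := by
  simp only [dvg, h.fderiv_eq]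

lemma support_dvg_subset (V : (𝔼 n) → 𝔼 n) : Function.support (dvg V) ⊆ tsupport V := by
  intro x hx
  by_contra h
  refine hx ?_
  rw [dvg_congr (notMem_tsupport_iff_eventuallyEq.1 h)]
  simp [dvg]

lemma continuous_dvg {V : (𝔼 n) → 𝔼 n} (hV : ContDiff ℝ 1 V) : Continuous (dvg V) := by
  have := hV.continuous_fderiv (by norm_num)
  unfold dvg
  fun_prop

lemma integral_dvg_eq_zero {V : (𝔼 n) → 𝔼 n} (hV : ContDiff ℝ 1 V) (hc : HasCompactSupport V) :
    ∫ x, dvg V x = 0 := by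
  have hcomp (i : Fin n) : ContDiff ℝ 1 fun x => V x i := by fun_prop
  have hsupp (i : Fin n) : HasCompactSupport fun x => V x i := hc.comp_left (g := fun v : 𝔼 n => v i) rfl
  have hfd (i : Fin n) (x : 𝔼 n) : fderiv ℝ V x (EuclideanSpace.single i 1) i
      = fderiv ℝ (fun y => V y i) x (EuclideanSpace.single i 1) := by
    have h1 := (hV.differentiable (by norm_num) x).hasFDerivAt
    have h2 := ((EuclideanSpace.proj i : (𝔼 n) →L[ℝ] ℝ).hasFDerivAt (x := V x)).comp x h1
    have h3 : fderiv ℝ (fun y => V y i) x = (EuclideanSpace.proj i : (𝔼 n) →L[ℝ] ℝ) ∘L fderiv ℝ V x :=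
      h2.fderiv
    rw [h3]; rfl
  have hcont (i : Fin n) :
      Continuous fun x => fderiv ℝ (fun y => V y i) x (EuclideanSpace.single i 1) :=
    ((hcomp i).continuous_fderiv (by norm_num)).clm_apply continuous_const
  have hInt (i : Fin n) : Integrable
      fun x => fderiv ℝ (fun y => V y i) x (EuclideanSpace.single i 1) :=
    (hcont i).integrable_of_hasCompactSupport ((hsupp i).fderiv_apply (𝕜 := ℝ) _)
  simp only [dvg, hfd]
  rw [integral_finsetSum _ fun i _ => hInt i]
  refine Finset.sum_eq_zero fun i _ => ?_
  have := integral_mul_fderiv_eq_neg_fderiv_mul_of_integrable (μ := (volume : Measure (𝔼 n)))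
    (f := fun _ => (1 : ℝ)) (g := fun x => V x i) (v := EuclideanSpace.single i 1) (by simp)
    (by simpa using hInt i)
    (by simpa using (hcomp i).continuous.integrable_of_hasCompactSupport (hsupp i)) (by simp)
    (fun x _ => (hcomp i).differentiable (by norm_num) x)
  simpa using this

lemma dvg_smul {f : (𝔼 n) → ℝ} {V : (𝔼 n) → 𝔼 n} {x : 𝔼 n} (hf : DifferentiableAt ℝ f x)
    (hV : DifferentiableAt ℝ V x) :
    dvg (fun y => f y • V y) x = f x * dvg V x + fderiv ℝ f x (V x) := by
  have h : fderiv ℝ (fun y => f y • V y) x = f x • fderiv ℝ V x + (fderiv ℝ f x).smulRight (V x) :=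
    (hf.hasFDerivAt.smul hV.hasFDerivAt).fderiv
  have hsum : V x = ∑ i, V x i • EuclideanSpace.single i (1 : ℝ) := by
    ext j
    simp [Finset.sum_apply, Pi.single_apply]
  conv_rhs => rw [hsum, map_sum]
  simp only [dvg, h, map_smul, smul_eq_mul]
  rw [Finset.mul_sum, ← Finset.sum_add_distrib]
  refine Finset.sum_congr rfl fun i _ => ?_
  simp [mul_comm]

lemma hasFDerivAt_radial {g : ℝ → ℝ} {g' : ℝ} {x : 𝔼 n} (hx : x ≠ 0) (hg : HasDerivAt g g' ‖x‖) :
    HasFDerivAt (fun y : 𝔼 n => g ‖y‖) ((g' / ‖x‖) • innerSL ℝ x) x := by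
  have h0 : ‖x‖ ≠ 0 := norm_ne_zero_iff.2 hx
  have h1 : HasFDerivAt (fun y : 𝔼 n => ‖y‖) ((1 / ‖x‖) • innerSL ℝ x) x := by
    have h2 := (hasStrictFDerivAt_norm_sq x).hasFDerivAt.sqrt (by positivity)
    simp only [Real.sqrt_sq (norm_nonneg _)] at h2
    refine h2.congr_fderiv ?_
    ext v
    simp
    field_simp
  refine (hg.comp_hasFDerivAt x h1).congr_fderiv ?_
  ext v
  simp
  ring

lemma fderiv_radial_apply {g : ℝ → ℝ} {g' : ℝ} {x : 𝔼 n} (hx : x ≠ 0) (hg : HasDerivAt g g' ‖x‖)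
    (v : 𝔼 n) : fderiv ℝ (fun y : 𝔼 n => g ‖y‖) x v = g' / ‖x‖ * inner ℝ x v := by
  rw [(hasFDerivAt_radial hx hg).fderiv]
  simp

lemma gradient_radial {g : ℝ → ℝ} {g' : ℝ} {x : 𝔼 n} (hx : x ≠ 0) (hg : HasDerivAt g g' ‖x‖) :
    gradient (fun y : 𝔼 n => g ‖y‖) x = (g' / ‖x‖) • x := by
  refine ext_inner_right ℝ fun v => ?_
  rw [inner_gradient_left, fderiv_radial_apply hx hg, inner_smul_left]
  simp

lemma dvg_radial {g : ℝ → ℝ} {g' : ℝ} {x : 𝔼 n} (hx : x ≠ 0) (hg : HasDerivAt g g' ‖x‖) :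
    dvg (fun y : 𝔼 n => g ‖y‖ • y) x = n * g ‖x‖ + ‖x‖ * g' := by
  have h0 : ‖x‖ ≠ 0 := norm_ne_zero_iff.2 hx
  rw [dvg_smul (V := fun y => y) (hasFDerivAt_radial hx hg).differentiableAt differentiableAt_fun_id,
    fderiv_radial_apply hx hg]
  have : dvg (fun y : 𝔼 n => y) x = n := by simp [dvg]
  rw [this, real_inner_self_eq_norm_sq]
  field_simp

end Divergence

section RadialProfile

/-- Hyperbolic distance to the origin as a function of the Euclidean norm. -/
noncomputable def hypDist (s : ℝ) : ℝ := Real.log ((1 + s) / (1 - s))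

/-- Conformal factor of the Poincaré ball as a function of the Euclidean norm. -/
noncomputable def confFactor (s : ℝ) : ℝ := 2 / (1 - s ^ 2)

variable {s : ℝ}

lemma confFactor_pos (h0 : -1 < s) (h1 : s < 1) : 0 < confFactor s := by
  unfold confFactor
  have : 0 < 1 - s ^ 2 := by nlinarith
  positivity

lemma hasDerivAt_confFactor (h0 : -1 < s) (h1 : s < 1) :
    HasDerivAt confFactor (s * confFactor s ^ 2) s := by
  have h : 1 - s ^ 2 ≠ 0 := by nlinarith
  refine ((hasDerivAt_const s (2 : ℝ)).div
    (((hasDerivAt_id s).pow 2).const_sub 1) h).congr_deriv ?_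
  unfold confFactor
  simp
  field_simp

lemma hasDerivAt_hypDist (h0 : -1 < s) (h1 : s < 1) :
    HasDerivAt hypDist (confFactor s) s := by
  have ha : 1 - s ≠ 0 := by linarith
  have hb : 1 + s ≠ 0 := by linarith
  refine ((((hasDerivAt_id s).const_add 1).div ((hasDerivAt_id s).const_sub 1) ha).log
    (div_ne_zero hb ha)).congr_deriv ?_
  unfold confFactor
  have : 1 - s ^ 2 ≠ 0 := by nlinarith
  simp
  field_simp
  ring

lemma two_mul_le_hypDist (h0 : 0 ≤ s) (h1 : s < 1) : 2 * s ≤ hypDist s := by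
  have h := Real.hasSum_log_sub_log_of_abs_lt_one (x := s) (by rwa [abs_of_nonneg h0])
  unfold hypDist
  rw [Real.log_div (by linarith) (by linarith)]
  simpa using le_hasSum h 0 fun k _ => by positivity

lemma hypDist_pos (h0 : 0 < s) (h1 : s < 1) : 0 < hypDist s := by
  linarith [two_mul_le_hypDist h0.le h1]

lemma one_le_hypDist_mul_coth (h0 : 0 < s) (h1 : s < 1) :
    1 ≤ hypDist s * ((1 + s ^ 2) / (2 * s)) := by
  have h := two_mul_le_hypDist h0.le h1
  calc (1 : ℝ) ≤ 2 * s * ((1 + s ^ 2) / (2 * s)) := by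
        field_simp
        nlinarith
    _ ≤ _ := by gcongr

end RadialProfile

section PointwiseInequality

lemma rellich_algebraic_inequality {n α a t L w Q u P q κ : ℝ} (ha : 0 < a) (hL : 0 < L)
    (hw : 0 < w) (hn : 1 ≤ n) (hκ : 1 ≤ κ) (hP : q ^ 2 ≤ P)
    (hh : 0 ≤ n + α - 4) (hm : 0 ≤ n - α) (hhm : n - α ≤ 2 * (n + α - 4)) :
    (-((n + α - 4) * (n - α) / 2)) *
        (a * t ^ 2 * u * Q + w * (a * t ^ 2 * P + u * ((α - 2) * (a * t) * L * q)))
      + (-((n + α - 4) ^ 2 * (n - α) / 8)) *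
        (u ^ 2 * (w * L ^ 2 * a * ((n - 1) * κ + (α - 3))) + 2 * u * (w * L * (a * t) * q))
      ≤ a * t ^ 4 * (1 / (w * L ^ 2)) * Q ^ 2 - (n - α) ^ 2 / 4 * (a * t ^ 2 * P * w) := by
  have h1 : 0 ≤ a / (w * L ^ 2) *
      (t ^ 2 * Q + (n + α - 4) * (n - α) / 4 * (w * L ^ 2) * u) ^ 2 := by positivity
  have h2 : 0 ≤ a * w * ((n - α) * (2 * (n + α - 4) - (n - α)) / 4) *
      (t * q + (n + α - 4) / 2 * u * L) ^ 2 := by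
    have : 0 ≤ 2 * (n + α - 4) - (n - α) := by linarith
    positivity
  have h3 : 0 ≤ a * w * ((n - α) * (2 * (n + α - 4) - (n - α)) / 4) * t ^ 2 * (P - q ^ 2) := by
    have : 0 ≤ 2 * (n + α - 4) - (n - α) := by linarith
    have : 0 ≤ P - q ^ 2 := by linarith
    positivity
  have h4 : 0 ≤ (n + α - 4) ^ 2 * (n - α) / 8 * ((n - 1) * (κ - 1)) * (u ^ 2 * w * L ^ 2 * a) := by
    have : 0 ≤ n - 1 := by linarith
    have : 0 ≤ κ - 1 := by linarith
    positivity
  have h5 : a / (w * L ^ 2) * (t ^ 2 * Q + (n + α - 4) * (n - α) / 4 * (w * L ^ 2) * u) ^ 2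
      = a * t ^ 4 * (1 / (w * L ^ 2)) * Q ^ 2
        + a * (2 * t ^ 2 * Q * ((n + α - 4) * (n - α) / 4) * u
          + ((n + α - 4) * (n - α) / 4) ^ 2 * (w * L ^ 2) * u ^ 2) := by
    field_simp
    ring
  rw [h5] at h1
  nlinarith [h1, h2, h3, h4]

end PointwiseInequality

section PunctureBall

variable {n : ℕ}

lemma lam_eq (x : 𝔼 n) : lam x = confFactor ‖x‖ := rfl

lemma dH_eq (x : 𝔼 n) : dH x = hypDist ‖x‖ := rfl

lemma norm_pos_and_lt_one {x : 𝔼 n} (hx : x ∈ Metric.ball (0 : 𝔼 n) 1 \ {0}) :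
    0 < ‖x‖ ∧ ‖x‖ < 1 :=
  ⟨norm_pos_iff.2 hx.2, mem_ball_zero_iff.1 hx.1⟩

lemma contDiffAt_confFactor {s : ℝ} (h0 : -1 < s) (h1 : s < 1) (m : WithTop ℕ∞) :
    ContDiffAt ℝ m confFactor s := by
  have h : 1 - s ^ 2 ≠ 0 := by nlinarith
  unfold confFactor
  fun_prop (disch := assumption)

lemma contDiffAt_hypDist {s : ℝ} (h0 : -1 < s) (h1 : s < 1) (m : WithTop ℕ∞) :
    ContDiffAt ℝ m hypDist s := by
  have ha : 1 - s ≠ 0 := by linarith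
  have hb : 1 + s ≠ 0 := by linarith
  have h : (1 + s) / (1 - s) ≠ 0 := div_ne_zero hb ha
  unfold hypDist
  exact ContDiffAt.log (by fun_prop (disch := assumption)) h

lemma contDiffAt_lam_rpow {x : 𝔼 n} (hx : x ∈ Metric.ball (0 : 𝔼 n) 1 \ {0}) (p : ℝ)
    (m : WithTop ℕ∞) : ContDiffAt ℝ m (fun y : 𝔼 n => lam y ^ p) x := by
  obtain ⟨h0, h1⟩ := norm_pos_and_lt_one hx
  have h2 : ContDiffAt ℝ m (fun y : 𝔼 n => confFactor ‖y‖) x :=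
    (contDiffAt_confFactor (by linarith) h1 m).comp x (contDiffAt_norm ℝ hx.2)
  exact h2.rpow_const_of_ne (confFactor_pos (by linarith) h1).ne'

lemma contDiffAt_dH_rpow {x : 𝔼 n} (hx : x ∈ Metric.ball (0 : 𝔼 n) 1 \ {0}) (p : ℝ)
    (m : WithTop ℕ∞) : ContDiffAt ℝ m (fun y : 𝔼 n => dH y ^ p) x := by
  obtain ⟨h0, h1⟩ := norm_pos_and_lt_one hx
  have h2 : ContDiffAt ℝ m (fun y : 𝔼 n => hypDist ‖y‖) x :=
    (contDiffAt_hypDist (by linarith) h1 m).comp x (contDiffAt_norm ℝ hx.2)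
  exact h2.rpow_const_of_ne (hypDist_pos h0 h1).ne'

lemma ContDiff.gradient {φ : (𝔼 n) → ℝ} (hφ : ContDiff ℝ (⊤ : ℕ∞) φ) :
    ContDiff ℝ (⊤ : ℕ∞) (gradient φ) :=
  (InnerProductSpace.toDual ℝ (𝔼 n)).symm.contDiff.comp
    (hφ.fderiv_right (m := (⊤ : ℕ∞)) (by simp))

lemma gradient_eq_zero_of_notMem_tsupport {φ : (𝔼 n) → ℝ} {x : 𝔼 n} (hx : x ∉ tsupport φ) :
    gradient φ x = 0 := by
  rw [(notMem_tsupport_iff_eventuallyEq.1 hx).gradient_eq]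
  exact gradient_const x 0

/-- A function vanishing off a closed set `K` has topological support in `K`. -/
lemma tsupport_subset_of_forall_notMem {F : Type*} [Zero F] {K : Set (𝔼 n)} (hK : IsClosed K)
    {f : (𝔼 n) → F} (hf : ∀ x, x ∉ K → f x = 0) : tsupport f ⊆ K :=
  closure_minimal (fun x hx => by_contra fun h => hx (hf x h)) hK

lemma dvg_radial_weight {x : 𝔼 n} (hx : x ∈ Metric.ball (0 : 𝔼 n) 1 \ {0}) (α : ℝ) :
    dvg (fun y : 𝔼 n => (confFactor ‖y‖ ^ ((n : ℝ) - 2) * confFactor ‖y‖ *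
        hypDist ‖y‖ ^ (α - 3) / ‖y‖) • y) x =
      lam x ^ ((n : ℝ) - 2) * lam x ^ 2 * dH x ^ (α - 4) *
        (((n : ℝ) - 1) * (dH x * ((1 + ‖x‖ ^ 2) / (2 * ‖x‖))) + (α - 3)) := by
  obtain ⟨h0, h1⟩ := norm_pos_and_lt_one hx
  have hL := confFactor_pos (by linarith) h1
  have ht := hypDist_pos h0 h1
  have hdL := hasDerivAt_confFactor (by linarith) h1
  have hdt := hasDerivAt_hypDist (by linarith) h1
  have hg := (((hdL.rpow_const (p := (n : ℝ) - 2) (Or.inl hL.ne')).mul hdL).mul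
    (hdt.rpow_const (p := α - 3) (Or.inl ht.ne'))).div (hasDerivAt_id ‖x‖) h0.ne'
  rw [dvg_radial (g := fun s => confFactor s ^ ((n : ℝ) - 2) * confFactor s *
    hypDist s ^ (α - 3) / s) hx.2 hg, lam_eq, dH_eq]
  have e1 : hypDist ‖x‖ ^ (α - 3) = hypDist ‖x‖ ^ (α - 4) * hypDist ‖x‖ := by
    rw [← Real.rpow_add_one ht.ne']; ring_nf
  have e2 : hypDist ‖x‖ ^ (α - 3 - 1) = hypDist ‖x‖ ^ (α - 4) := by ring_nf
  have e3 : confFactor ‖x‖ ^ ((n : ℝ) - 2 - 1) = confFactor ‖x‖ ^ ((n : ℝ) - 2) / confFactor ‖x‖ :=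
    Real.rpow_sub_one hL.ne' _
  have e5 : confFactor ‖x‖ * (1 + ‖x‖ ^ 2) = 2 + 2 * confFactor ‖x‖ * ‖x‖ ^ 2 := by
    have : 1 - ‖x‖ ^ 2 ≠ 0 := by nlinarith
    unfold confFactor
    field_simp
    ring
  simp only [Pi.mul_apply, id]
  rw [e1, e2, e3]
  generalize hypDist ‖x‖ ^ (α - 4) = a at *
  generalize confFactor ‖x‖ ^ ((n : ℝ) - 2) = w at *
  generalize confFactor ‖x‖ = L at *
  generalize hypDist ‖x‖ = t at *
  generalize ‖x‖ = s at *
  field_simp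
  linear_combination (-(n - 1) * t * w * a) * e5

lemma dvg_weight_smul_gradient {φ : (𝔼 n) → ℝ} (hφ : ContDiff ℝ (⊤ : ℕ∞) φ) {x : 𝔼 n}
    (hx : x ∈ Metric.ball (0 : 𝔼 n) 1 \ {0}) (α : ℝ) :
    dvg (fun y : 𝔼 n => (dH y ^ (α - 2) * φ y) • (lam y ^ ((n : ℝ) - 2) • gradient φ y)) x =
      dH x ^ (α - 4) * dH x ^ 2 * φ x *
        dvg (fun y => lam y ^ ((n : ℝ) - 2) • gradient φ y) x
      + lam x ^ ((n : ℝ) - 2) * (dH x ^ (α - 4) * dH x ^ 2 * ‖gradient φ x‖ ^ 2 +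
        φ x * ((α - 2) * (dH x ^ (α - 4) * dH x) * lam x *
          (inner ℝ x (gradient φ x) / ‖x‖))) := by
  obtain ⟨h0, h1⟩ := norm_pos_and_lt_one hx
  have ht := hypDist_pos h0 h1
  have hdt := hasDerivAt_hypDist (by linarith) h1
  have hd1 := hasFDerivAt_radial hx.2 (hdt.rpow_const (p := α - 2) (Or.inl ht.ne'))
  have hd2 := (hφ.differentiable (by simp) x).hasFDerivAt
  have hd3 : HasFDerivAt (fun y => dH y ^ (α - 2) * φ y) _ x := hd1.mul hd2
  have hW : DifferentiableAt ℝ (fun y => lam y ^ ((n : ℝ) - 2) • gradient φ y) x :=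
    (((contDiffAt_lam_rpow hx _ 1).differentiableAt (by simp)).smul
      ((hφ.gradient).differentiable (by simp) x))
  have e1 : hypDist ‖x‖ ^ (α - 2) = hypDist ‖x‖ ^ (α - 4) * hypDist ‖x‖ ^ 2 := by
    rw [← Real.rpow_add_natCast ht.ne']; congr 1; push_cast; ring
  have e2 : hypDist ‖x‖ ^ (α - 2 - 1) = hypDist ‖x‖ ^ (α - 4) * hypDist ‖x‖ := by
    rw [← Real.rpow_add_one ht.ne']; ring_nf
  have e3 := hd3.fderiv
  rw [dvg_smul hd3.differentiableAt hW, e3]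
  simp only [lam_eq, dH_eq, add_apply, smul_apply,
    innerSL_apply_apply, ← inner_gradient_left, inner_smul_right, real_inner_self_eq_norm_sq, e1, e2,
    smul_eq_mul]
  field_simp

lemma contDiffAt_radial_weight {x : 𝔼 n} (hx : x ∈ Metric.ball (0 : 𝔼 n) 1 \ {0}) (α : ℝ)
    (m : WithTop ℕ∞) :
    ContDiffAt ℝ m (fun y : 𝔼 n => (confFactor ‖y‖ ^ ((n : ℝ) - 2) * confFactor ‖y‖ *
        hypDist ‖y‖ ^ (α - 3) / ‖y‖) • y) x := by
  have a1 := contDiffAt_lam_rpow hx ((n : ℝ) - 2) m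
  have a2 := contDiffAt_lam_rpow hx 1 m
  have a3 := contDiffAt_dH_rpow hx (α - 3) m
  simp only [lam_eq, dH_eq, Real.rpow_one] at a1 a2 a3
  exact (((a1.mul a2).mul a3).div (contDiffAt_norm ℝ hx.2) (norm_ne_zero_iff.2 hx.2)).smul
    contDiffAt_id

lemma dvg_sq_smul_radial_weight {φ : (𝔼 n) → ℝ} (hφ : ContDiff ℝ (⊤ : ℕ∞) φ) {x : 𝔼 n}
    (hx : x ∈ Metric.ball (0 : 𝔼 n) 1 \ {0}) (α : ℝ) :
    dvg (fun y : 𝔼 n => (φ y ^ 2) • ((confFactor ‖y‖ ^ ((n : ℝ) - 2) * confFactor ‖y‖ *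
        hypDist ‖y‖ ^ (α - 3) / ‖y‖) • y)) x =
      φ x ^ 2 * (lam x ^ ((n : ℝ) - 2) * lam x ^ 2 * dH x ^ (α - 4) *
        (((n : ℝ) - 1) * (dH x * ((1 + ‖x‖ ^ 2) / (2 * ‖x‖))) + (α - 3)))
      + 2 * φ x * (lam x ^ ((n : ℝ) - 2) * lam x * (dH x ^ (α - 4) * dH x) *
          (inner ℝ x (gradient φ x) / ‖x‖)) := by
  obtain ⟨h0, h1⟩ := norm_pos_and_lt_one hx
  have ht := hypDist_pos h0 h1
  have hd2 := (hφ.differentiable (by simp) x).hasFDerivAt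
  have e1 : hypDist ‖x‖ ^ (α - 3) = hypDist ‖x‖ ^ (α - 4) * hypDist ‖x‖ := by
    rw [← Real.rpow_add_one ht.ne']; ring_nf
  have hV : DifferentiableAt ℝ (fun y : 𝔼 n => (confFactor ‖y‖ ^ ((n : ℝ) - 2) * confFactor ‖y‖ *
        hypDist ‖y‖ ^ (α - 3) / ‖y‖) • y) x := by
    exact (contDiffAt_radial_weight hx α 1).differentiableAt (by simp)
  rw [dvg_smul (hd2.pow 2).differentiableAt hV, dvg_radial_weight hx, (hd2.pow 2).fderiv]
  simp only [lam_eq, dH_eq, smul_apply, ← inner_gradient_left,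
    inner_smul_right, e1, smul_eq_mul]
  rw [real_inner_comm]
  field_simp
  norm_num
  ring

end PunctureBall

section LowerBound

variable {n : ℕ} {φ : (𝔼 n) → ℝ}

lemma contDiff_lam_rpow_smul_gradient (hφ : ContDiff ℝ (⊤ : ℕ∞) φ)
    (hs : tsupport φ ⊆ Metric.ball (0 : 𝔼 n) 1 \ {0}) :
    ContDiff ℝ (⊤ : ℕ∞) (fun y => lam y ^ ((n : ℝ) - 2) • gradient φ y) ∧
      tsupport (fun y => lam y ^ ((n : ℝ) - 2) • gradient φ y) ⊆ tsupport φ := by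
  have h := tsupport_subset_of_forall_notMem (isClosed_tsupport φ)
    (f := fun y => lam y ^ ((n : ℝ) - 2) • gradient φ y)
    fun x hx => by simp [gradient_eq_zero_of_notMem_tsupport hx]
  exact ⟨contDiff_of_forall_mem_tsupport fun x hx =>
    (contDiffAt_lam_rpow (hs (h hx)) _ _).smul hφ.gradient.contDiffAt, h⟩

lemma dvg_lam_rpow_smul_gradient_eq_zero {x : 𝔼 n} (hx : x ∉ tsupport φ) :
    dvg (fun y => lam y ^ ((n : ℝ) - 2) • gradient φ y) x = 0 := by
  have h := tsupport_subset_of_forall_notMem (isClosed_tsupport φ)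
    (f := fun y => lam y ^ ((n : ℝ) - 2) • gradient φ y)
    fun x hx => by simp [gradient_eq_zero_of_notMem_tsupport hx]
  by_contra h'
  exact hx (h (support_dvg_subset _ h'))

/-- A compactly supported function, supported where it is known to be continuous. -/
lemma continuous_and_hasCompactSupport (hc : HasCompactSupport φ) {f : (𝔼 n) → ℝ}
    (h0 : ∀ x ∉ tsupport φ, f x = 0) (hf : ∀ x ∈ tsupport φ, ContinuousAt f x) :
    Continuous f ∧ HasCompactSupport f := by
  have h := tsupport_subset_of_forall_notMem (isClosed_tsupport φ) h0
  exact ⟨continuous_of_tsupport fun x hx => hf x (h hx), hc.of_isClosed_subset (isClosed_tsupport f) h⟩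

lemma rellich_numerator_regular (hφ : ContDiff ℝ (⊤ : ℕ∞) φ) (hc : HasCompactSupport φ)
    (hs : tsupport φ ⊆ Metric.ball (0 : 𝔼 n) 1 \ {0}) (α : ℝ) :
    Continuous (fun x => dH x ^ α * lam x ^ (-(n : ℝ)) *
        (dvg (fun y => lam y ^ ((n : ℝ) - 2) • gradient φ y) x) ^ 2) ∧
      HasCompactSupport (fun x => dH x ^ α * lam x ^ (-(n : ℝ)) *
        (dvg (fun y => lam y ^ ((n : ℝ) - 2) • gradient φ y) x) ^ 2) := by
  refine continuous_and_hasCompactSupport hc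
    (fun x hx => by simp [dvg_lam_rpow_smul_gradient_eq_zero hx]) fun x hx => ?_
  exact ((contDiffAt_dH_rpow (hs hx) _ 0).continuousAt.mul
    (contDiffAt_lam_rpow (hs hx) _ 0).continuousAt).mul
    ((continuous_dvg ((contDiff_lam_rpow_smul_gradient hφ hs).1.of_le
      (by exact_mod_cast le_top))).continuousAt.pow 2)

lemma rellich_denominator_regular (hφ : ContDiff ℝ (⊤ : ℕ∞) φ) (hc : HasCompactSupport φ)
    (hs : tsupport φ ⊆ Metric.ball (0 : 𝔼 n) 1 \ {0}) (α : ℝ) :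
    Continuous (fun x => dH x ^ (α - 2) * ‖gradient φ x‖ ^ 2 * lam x ^ ((n : ℝ) - 2)) ∧
      HasCompactSupport
        (fun x => dH x ^ (α - 2) * ‖gradient φ x‖ ^ 2 * lam x ^ ((n : ℝ) - 2)) := by
  refine continuous_and_hasCompactSupport hc
    (fun x hx => by simp [gradient_eq_zero_of_notMem_tsupport hx]) fun x hx => ?_
  exact ((contDiffAt_dH_rpow (hs hx) _ 0).continuousAt.mul
    (hφ.gradient.continuous.norm.continuousAt.pow 2)).mul
    (contDiffAt_lam_rpow (hs hx) _ 0).continuousAt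

lemma setIntegral_ball_rellich_denominator (hs : tsupport φ ⊆ Metric.ball (0 : 𝔼 n) 1 \ {0})
    (α : ℝ) :
    ∫ x in Metric.ball (0 : 𝔼 n) 1, dH x ^ (α - 2) * ‖gradient φ x‖ ^ 2 * lam x ^ ((n : ℝ) - 2) =
      ∫ x, dH x ^ (α - 2) * ‖gradient φ x‖ ^ 2 * lam x ^ ((n : ℝ) - 2) :=
  setIntegral_eq_integral_of_forall_compl_eq_zero fun x hx => by
    simp [gradient_eq_zero_of_notMem_tsupport fun h => hx (hs h).1]

lemma setIntegral_ball_rellich_numerator (hs : tsupport φ ⊆ Metric.ball (0 : 𝔼 n) 1 \ {0})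
    (α : ℝ) :
    ∫ x in Metric.ball (0 : 𝔼 n) 1, dH x ^ α * lam x ^ (-(n : ℝ)) *
        (dvg (fun y => lam y ^ ((n : ℝ) - 2) • gradient φ y) x) ^ 2 =
      ∫ x, dH x ^ α * lam x ^ (-(n : ℝ)) *
        (dvg (fun y => lam y ^ ((n : ℝ) - 2) • gradient φ y) x) ^ 2 :=
  setIntegral_eq_integral_of_forall_compl_eq_zero fun x hx => by
    simp [dvg_lam_rpow_smul_gradient_eq_zero fun h => hx (hs h).1]

lemma rellich_denominator_pos (hφ : ContDiff ℝ (⊤ : ℕ∞) φ) (hc : HasCompactSupport φ)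
    (hs : tsupport φ ⊆ Metric.ball (0 : 𝔼 n) 1 \ {0}) (h0 : φ ≠ 0) (α : ℝ) :
    0 < ∫ x in Metric.ball (0 : 𝔼 n) 1,
      dH x ^ (α - 2) * ‖gradient φ x‖ ^ 2 * lam x ^ ((n : ℝ) - 2) := by
  rw [setIntegral_ball_rellich_denominator hs]
  obtain ⟨x, hx⟩ : ∃ x, gradient φ x ≠ 0 := by
    by_contra! h
    refine h0 (funext fun x => ?_)
    have h1 := is_const_of_fderiv_eq_zero (𝕜 := ℝ) (hφ.differentiable (by simp))
      (fun y => by rw [← toDual_gradient, h y, map_zero]) x 0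
    rw [h1]
    by_contra h2
    exact (hs (subset_tsupport φ h2)).2 rfl
  obtain ⟨hcont, hcomp⟩ := rellich_denominator_regular hφ hc hs α
  have hpos (y : 𝔼 n) (hy : y ∈ tsupport φ) : 0 < dH y ∧ 0 < lam y := by
    obtain ⟨h1, h2⟩ := norm_pos_and_lt_one (hs hy)
    exact ⟨hypDist_pos h1 h2, confFactor_pos (by linarith) h2⟩
  refine hcont.integral_pos_of_hasCompactSupport_nonneg_nonzero (x := x) hcomp (fun y => ?_) ?_
  · by_cases hy : y ∈ tsupport φ
    · obtain ⟨h1, h2⟩ := hpos y hy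
      simp only [Pi.zero_apply]
      positivity
    · simp [gradient_eq_zero_of_notMem_tsupport hy]
  · obtain ⟨h1, h2⟩ := hpos x (by_contra fun h => hx (gradient_eq_zero_of_notMem_tsupport h))
    have := norm_pos_iff.2 hx
    positivity

theorem weighted_rellich_hyperbolic (hn : 2 < n) {α : ℝ} (hα₁ : (8 - (n : ℝ)) / 3 < α)
    (hα₂ : α < 2) (hφ : ContDiff ℝ (⊤ : ℕ∞) φ) (hc : HasCompactSupport φ)
    (hs : tsupport φ ⊆ Metric.ball (0 : 𝔼 n) 1 \ {0}) :
    ((n : ℝ) - α) ^ 2 / 4 * (∫ x in Metric.ball (0 : 𝔼 n) 1,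
        dH x ^ (α - 2) * ‖gradient φ x‖ ^ 2 * lam x ^ ((n : ℝ) - 2)) ≤
      ∫ x in Metric.ball (0 : 𝔼 n) 1, dH x ^ α * lam x ^ (-(n : ℝ)) *
        (dvg (fun y => lam y ^ ((n : ℝ) - 2) • gradient φ y) x) ^ 2 := by
  have hn' : (2 : ℝ) < n := by exact_mod_cast hn
  rw [setIntegral_ball_rellich_denominator hs, setIntegral_ball_rellich_numerator hs]
  obtain ⟨hA, hA'⟩ := rellich_numerator_regular hφ hc hs α
  obtain ⟨hB, hB'⟩ := rellich_denominator_regular hφ hc hs α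
  obtain ⟨hW, -⟩ := contDiff_lam_rpow_smul_gradient hφ hs
  set V₁ : (𝔼 n) → 𝔼 n := fun y =>
    (dH y ^ (α - 2) * φ y) • (lam y ^ ((n : ℝ) - 2) • gradient φ y) with hV₁
  set V₂ : (𝔼 n) → 𝔼 n := fun y => (φ y ^ 2) • ((confFactor ‖y‖ ^ ((n : ℝ) - 2) *
    confFactor ‖y‖ * hypDist ‖y‖ ^ (α - 3) / ‖y‖) • y) with hV₂
  have hsupp₁ : tsupport V₁ ⊆ tsupport φ :=
    tsupport_subset_of_forall_notMem (isClosed_tsupport φ) fun x hx => by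
      simp [hV₁, image_eq_zero_of_notMem_tsupport hx]
  have hsupp₂ : tsupport V₂ ⊆ tsupport φ :=
    tsupport_subset_of_forall_notMem (isClosed_tsupport φ) fun x hx => by
      simp [hV₂, image_eq_zero_of_notMem_tsupport hx]
  have hC₁ : ContDiff ℝ 1 V₁ := contDiff_of_forall_mem_tsupport fun x hx =>
    ((contDiffAt_dH_rpow (hs (hsupp₁ hx)) _ _).mul (hφ.contDiffAt.of_le
      (by exact_mod_cast le_top))).smul (hW.contDiffAt.of_le (by exact_mod_cast le_top))
  have hC₂ : ContDiff ℝ 1 V₂ := contDiff_of_forall_mem_tsupport fun x hx =>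
    ((hφ.contDiffAt.of_le (by exact_mod_cast le_top)).pow 2).smul
      (contDiffAt_radial_weight (hs (hsupp₂ hx)) _ _)
  have hK₁ : HasCompactSupport V₁ := hc.of_isClosed_subset (isClosed_tsupport _) hsupp₁
  have hK₂ : HasCompactSupport V₂ := hc.of_isClosed_subset (isClosed_tsupport _) hsupp₂
  have hdvg (V : (𝔼 n) → 𝔼 n) (h : ContDiff ℝ 1 V) (h' : HasCompactSupport V) :
      Integrable (dvg V) :=
    (continuous_dvg h).integrable_of_hasCompactSupport
      (h'.of_isClosed_subset (isClosed_tsupport _)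
        (closure_minimal (support_dvg_subset V) (isClosed_tsupport _)))
  have hintA := hA.integrable_of_hasCompactSupport (μ := volume) hA'
  have hintB := hB.integrable_of_hasCompactSupport (μ := volume) hB'
  have hpt (x : 𝔼 n) :
      (-(((n : ℝ) + α - 4) * (n - α) / 2)) * dvg V₁ x +
        (-(((n : ℝ) + α - 4) ^ 2 * (n - α) / 8)) * dvg V₂ x ≤
      dH x ^ α * lam x ^ (-(n : ℝ)) *
        (dvg (fun y => lam y ^ ((n : ℝ) - 2) • gradient φ y) x) ^ 2 -
      ((n : ℝ) - α) ^ 2 / 4 *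
        (dH x ^ (α - 2) * ‖gradient φ x‖ ^ 2 * lam x ^ ((n : ℝ) - 2)) := by
    by_cases hx : x ∈ tsupport φ
    · have hxU := hs hx
      obtain ⟨h0, h1⟩ := norm_pos_and_lt_one hxU
      have hL : 0 < lam x := confFactor_pos (by linarith) h1
      have ht : 0 < dH x := hypDist_pos h0 h1
      have e1 : dH x ^ α = dH x ^ (α - 4) * dH x ^ 4 := by
        rw [← Real.rpow_add_natCast ht.ne']; congr 1; push_cast; ring
      have e2 : dH x ^ (α - 2) = dH x ^ (α - 4) * dH x ^ 2 := by
        rw [← Real.rpow_add_natCast ht.ne']; congr 1; push_cast; ring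
      have e3 : lam x ^ (-(n : ℝ)) = 1 / (lam x ^ ((n : ℝ) - 2) * lam x ^ 2) := by
        rw [← Real.rpow_add_natCast hL.ne', Real.rpow_neg hL.le, one_div]; congr 2; push_cast; ring
      rw [hV₁, hV₂, dvg_weight_smul_gradient hφ hxU, dvg_sq_smul_radial_weight hφ hxU, e1, e2, e3]
      refine rellich_algebraic_inequality (by positivity) hL (by positivity) (by linarith)
        (one_le_hypDist_mul_coth h0 h1) ?_ (by linarith) (by linarith) (by linarith)
      rw [← sq_abs, abs_div, abs_norm]
      gcongr
      rw [div_le_iff₀ h0, mul_comm]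
      exact abs_real_inner_le_norm x _
    · have z₁ : dvg V₁ x = 0 := by
        by_contra h; exact hx (hsupp₁ (support_dvg_subset _ h))
      have z₂ : dvg V₂ x = 0 := by
        by_contra h; exact hx (hsupp₂ (support_dvg_subset _ h))
      simp [z₁, z₂, dvg_lam_rpow_smul_gradient_eq_zero hx, gradient_eq_zero_of_notMem_tsupport hx]
  have hmono := integral_mono (((hdvg V₁ hC₁ hK₁).const_mul _).add
    ((hdvg V₂ hC₂ hK₂).const_mul _)) (hintA.sub (hintB.const_mul _)) hpt
  simp only [Pi.add_apply, Pi.sub_apply] at hmono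
  rw [integral_add ((hdvg V₁ hC₁ hK₁).const_mul _) ((hdvg V₂ hC₂ hK₂).const_mul _),
    integral_sub hintA (hintB.const_mul _), integral_const_mul, integral_const_mul,
    integral_const_mul, integral_dvg_eq_zero hC₁ hK₁, integral_dvg_eq_zero hC₂ hK₂] at hmono
  linarith

end LowerBound

section TestFunctions

/-- The logarithmic derivative `k χ' + β χ` of the profile `s ↦ s ^ β * χ (k * log s)`. -/
noncomputable def logDerivProfile (χ : ℝ → ℝ) (β k v : ℝ) : ℝ := β * χ v + k * deriv χ v

lemma hasDerivAt_rpow_mul_comp_log {χ : ℝ → ℝ} {χ' β k s : ℝ} (hs : 0 < s)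
    (hχ : HasDerivAt χ χ' (k * Real.log s)) :
    HasDerivAt (fun s => s ^ β * χ (k * Real.log s))
      (s ^ (β - 1) * (β * χ (k * Real.log s) + k * χ')) s := by
  have h1 : HasDerivAt (fun s => χ (k * Real.log s)) (χ' * (k * s⁻¹)) s :=
    hχ.comp s ((Real.hasDerivAt_log hs.ne').const_mul k)
  refine ((Real.hasDerivAt_rpow_const (p := β) (Or.inl hs.ne')).mul h1).congr_deriv ?_
  rw [Real.rpow_sub_one hs.ne']
  field_simp

lemma hasDerivAt_logDerivProfile {χ : ℝ → ℝ} (hχ : ContDiff ℝ (⊤ : ℕ∞) χ) (β k v : ℝ) :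
    HasDerivAt (logDerivProfile χ β k) (logDerivProfile (deriv χ) β k v) v := by
  have h1 : ContDiff ℝ (⊤ : ℕ∞) (deriv χ) := (contDiff_infty_iff_deriv.1 hχ).2
  exact ((hχ.differentiable (by simp) v).hasDerivAt.const_mul β).add
    ((h1.differentiable (by simp) v).hasDerivAt.const_mul k)

lemma continuous_logDerivProfile {χ : ℝ → ℝ} (hχ : ContDiff ℝ (⊤ : ℕ∞) χ) (β : ℝ) :
    Continuous fun p : ℝ × ℝ × ℝ => logDerivProfile χ β p.1 p.2.2 := by
  have h0 := hχ.continuous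
  have h1 := hχ.continuous_deriv (by simp)
  unfold logDerivProfile
  fun_prop

lemma logDerivProfile_eq_zero {χ : ℝ → ℝ} {v : ℝ} (hv : v ∉ tsupport χ) (β k : ℝ) :
    logDerivProfile χ β k v = 0 := by
  have h : deriv χ v = 0 := by
    by_contra h
    exact hv (support_deriv_subset h)
  simp [logDerivProfile, image_eq_zero_of_notMem_tsupport hv, h]

/-- The density of the numerator of the Rellich quotient of `‖x‖ ^ β * χ (k * log ‖x‖)` in the
variables `s = ‖x‖` and `v = k * log s`. -/
noncomputable def numeratorDensity (ν α β : ℝ) (χ : ℝ → ℝ) (p : ℝ × ℝ × ℝ) : ℝ :=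
  dslope hypDist 0 p.2.1 ^ α * confFactor p.2.1 ^ (ν - 4) *
    ((ν + β - 2) * logDerivProfile χ β p.1 p.2.2 +
      p.1 * logDerivProfile (deriv χ) β p.1 p.2.2 +
      (ν - 2) * confFactor p.2.1 * p.2.1 ^ 2 * logDerivProfile χ β p.1 p.2.2) ^ 2

/-- The density of the denominator of the Rellich quotient of `‖x‖ ^ β * χ (k * log ‖x‖)` in the
variables `s = ‖x‖` and `v = k * log s`. -/
noncomputable def denominatorDensity (ν α β : ℝ) (χ : ℝ → ℝ) (p : ℝ × ℝ × ℝ) : ℝ :=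
  dslope hypDist 0 p.2.1 ^ (α - 2) * confFactor p.2.1 ^ (ν - 2) *
    logDerivProfile χ β p.1 p.2.2 ^ 2

lemma dslope_hypDist_zero : dslope hypDist 0 0 = 2 := by
  rw [dslope_same, (hasDerivAt_hypDist (by norm_num) (by norm_num)).deriv]
  simp [confFactor]

lemma hypDist_eq_mul_dslope (s : ℝ) : hypDist s = s * dslope hypDist 0 s := by
  have h := sub_smul_dslope hypDist 0 s
  simpa [hypDist] using h.symm

lemma dslope_hypDist_pos {s : ℝ} (h0 : 0 ≤ s) (h1 : s < 1) : 0 < dslope hypDist 0 s := by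
  rcases h0.eq_or_lt with rfl | h0
  · rw [dslope_hypDist_zero]; norm_num
  · have h := hypDist_pos h0 h1
    rw [hypDist_eq_mul_dslope] at h
    exact pos_of_mul_pos_right h h0.le

lemma continuousOn_density_weight (p q : ℝ) :
    ContinuousOn (fun z : ℝ × ℝ × ℝ => dslope hypDist 0 z.2.1 ^ p * confFactor z.2.1 ^ q)
      (Set.Icc 0 1 ×ˢ Set.Icc 0 (1 / 2) ×ˢ Set.Icc (-2) (-1)) := by
  have hD : ContinuousOn (dslope hypDist 0) (Set.Ioo (-1) 1) := by
    refine (continuousOn_dslope (Ioo_mem_nhds (by norm_num) (by norm_num))).2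
      ⟨fun s hs => (hasDerivAt_hypDist hs.1 hs.2).continuousAt.continuousWithinAt,
        (hasDerivAt_hypDist (by norm_num) (by norm_num)).differentiableAt⟩
  have hC : ContinuousOn confFactor (Set.Ioo (-1) 1) := fun s hs =>
    (hasDerivAt_confFactor hs.1 hs.2).continuousAt.continuousWithinAt
  have hmaps : Set.MapsTo (fun z : ℝ × ℝ × ℝ => z.2.1)
      (Set.Icc 0 1 ×ˢ Set.Icc 0 (1 / 2) ×ˢ Set.Icc (-2) (-1)) (Set.Ioo (-1 : ℝ) 1) := by
    rintro ⟨k, s, v⟩ ⟨-, ⟨h1, h2⟩, -⟩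
    exact ⟨by simp only at h1; linarith, by simp only at h2; linarith⟩
  have hcont : ContinuousOn (fun z : ℝ × ℝ × ℝ => z.2.1)
      (Set.Icc 0 1 ×ˢ Set.Icc 0 (1 / 2) ×ˢ Set.Icc (-2) (-1)) := by fun_prop
  refine ((hD.comp hcont hmaps).rpow_const fun z hz => Or.inl ?_).mul
    ((hC.comp hcont hmaps).rpow_const fun z hz => Or.inl ?_)
  · exact (dslope_hypDist_pos hz.2.1.1 (hmaps hz).2).ne'
  · exact (confFactor_pos (hmaps hz).1 (hmaps hz).2).ne'

lemma continuousOn_denominatorDensity {χ : ℝ → ℝ} (hχ : ContDiff ℝ (⊤ : ℕ∞) χ) (ν α β : ℝ) :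
    ContinuousOn (denominatorDensity ν α β χ)
      (Set.Icc 0 1 ×ˢ Set.Icc 0 (1 / 2) ×ˢ Set.Icc (-2) (-1)) :=
  (continuousOn_density_weight _ _).mul ((continuous_logDerivProfile hχ β).pow 2).continuousOn

lemma continuousOn_numeratorDensity {χ : ℝ → ℝ} (hχ : ContDiff ℝ (⊤ : ℕ∞) χ) (ν α β : ℝ) :
    ContinuousOn (numeratorDensity ν α β χ)
      (Set.Icc 0 1 ×ˢ Set.Icc 0 (1 / 2) ×ˢ Set.Icc (-2) (-1)) := by
  have h1 := (continuous_logDerivProfile hχ β).continuousOn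
    (s := Set.Icc 0 1 ×ˢ Set.Icc 0 (1 / 2) ×ˢ Set.Icc (-2) (-1))
  have h2 := (continuous_logDerivProfile (contDiff_infty_iff_deriv.1 hχ).2 β).continuousOn
    (s := Set.Icc 0 1 ×ˢ Set.Icc 0 (1 / 2) ×ˢ Set.Icc (-2) (-1))
  have h3 := continuousOn_density_weight 0 1
  simp only [Real.rpow_zero, one_mul, Real.rpow_one] at h3
  refine (continuousOn_density_weight _ _).mul (ContinuousOn.pow ?_ 2)
  fun_prop

lemma tendsto_setIntegral_exp_of_continuousOn {H : ℝ × ℝ × ℝ → ℝ}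
    (hH : ContinuousOn H (Set.Icc 0 1 ×ˢ Set.Icc 0 (1 / 2) ×ˢ Set.Icc (-2) (-1))) :
    Filter.Tendsto (fun N : ℕ => ∫ v in Set.Icc (-2 : ℝ) (-1),
        H (1 / ((N : ℝ) + 1), Real.exp (v / (1 / ((N : ℝ) + 1))), v)) Filter.atTop
      (nhds (∫ v in Set.Icc (-2 : ℝ) (-1), H (0, 0, v))) := by
  obtain ⟨C, hC⟩ := (isCompact_Icc.prod (isCompact_Icc.prod isCompact_Icc)).exists_bound_of_continuousOn hH
  have hmem (N : ℕ) (v : ℝ) (hv : v ∈ Set.Icc (-2 : ℝ) (-1)) :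
      (1 / ((N : ℝ) + 1), Real.exp (v / (1 / ((N : ℝ) + 1))), v) ∈
        (Set.Icc 0 1 ×ˢ Set.Icc 0 (1 / 2) ×ˢ Set.Icc (-2) (-1) : Set (ℝ × ℝ × ℝ)) := by
    have hN : (0 : ℝ) ≤ N := N.cast_nonneg
    refine ⟨⟨by positivity, ?_⟩, ⟨(Real.exp_pos _).le, ?_⟩, hv⟩
    · rw [div_le_one (by positivity)]; linarith
    · have h1 : v / (1 / ((N : ℝ) + 1)) ≤ -1 := by
        rw [div_div_eq_mul_div, div_one]
        nlinarith [hv.2]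
      calc Real.exp (v / (1 / ((N : ℝ) + 1))) ≤ Real.exp (-1) := Real.exp_le_exp.2 h1
        _ ≤ 1 / 2 := by
          rw [Real.exp_neg, one_div]
          gcongr
          linarith [Real.add_one_le_exp (1 : ℝ)]
  refine tendsto_integral_of_dominated_convergence (fun _ => C) (fun N => ?_)
    (integrable_const C) (fun N => ?_) ?_
  · refine ContinuousOn.aestronglyMeasurable (hH.comp (by fun_prop) fun v hv => hmem N v hv)
      measurableSet_Icc
  · filter_upwards [ae_restrict_mem measurableSet_Icc] with v hv using hC _ (hmem N v hv)
  · filter_upwards [ae_restrict_mem measurableSet_Icc] with v hv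
    refine (hH (0, 0, v) ⟨by simp, by simp, hv⟩).tendsto.comp
      (tendsto_nhdsWithin_iff.2 ⟨?_, Filter.Eventually.of_forall fun N => hmem N v hv⟩)
    refine tendsto_one_div_add_atTop_nhds_zero_nat.prodMk_nhds
      (Filter.Tendsto.prodMk_nhds (Real.tendsto_exp_atBot.comp ?_) tendsto_const_nhds)
    simp only [div_div_eq_mul_div, div_one]
    refine Filter.Tendsto.const_mul_atTop_of_neg (by linarith [hv.2]) ?_
    exact Filter.tendsto_atTop_add_const_right _ _ tendsto_natCast_atTop_atTop

lemma integral_norm_eq_integral_exp {n : ℕ} [NeZero n] (H : ℝ → ℝ) {k : ℝ} (hk : 0 < k) :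
    ∫ x : 𝔼 n, (‖x‖ ^ n)⁻¹ * H ‖x‖ =
      (n * (volume : Measure (𝔼 n)).real (Metric.ball 0 1) * k⁻¹) *
        ∫ v, H (Real.exp (v / k)) := by
  have hn : n ≠ 0 := NeZero.ne n
  have : Nontrivial (𝔼 n) := by
    have : Nonempty (Fin n) := ⟨⟨0, Nat.pos_of_ne_zero hn⟩⟩
    infer_instance
  have himg : (fun v => Real.exp (v / k)) '' Set.univ = Set.Ioi 0 := by
    ext y
    simp only [Set.image_univ, Set.mem_range, Set.mem_Ioi]
    refine ⟨fun ⟨v, hv⟩ => hv ▸ Real.exp_pos _, fun hy => ⟨k * Real.log y, ?_⟩⟩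
    rw [mul_div_cancel_left₀ _ hk.ne', Real.exp_log hy]
  have hder (v : ℝ) : HasDerivAt (fun v => Real.exp (v / k)) (Real.exp (v / k) * (1 / k)) v :=
    ((hasDerivAt_id v).div_const k).exp
  have hinj : Set.InjOn (fun v => Real.exp (v / k)) Set.univ := fun a _ b _ hab => by
    have := Real.exp_injective hab
    field_simp at this
    exact this
  rw [integral_fun_norm_addHaar volume fun s => (s ^ n)⁻¹ * H s, ← himg,
    integral_image_eq_integral_abs_deriv_smul MeasurableSet.univ
      (fun v _ => (hder v).hasDerivWithinAt) hinj]
  simp only [finrank_euclideanSpace_fin, smul_eq_mul, Measure.restrict_univ, nsmul_eq_mul]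
  rw [mul_assoc _ k⁻¹, mul_assoc, ← integral_const_mul k⁻¹]
  congr 3
  ext v
  have h0 := Real.exp_pos (v / k)
  rw [abs_of_pos (by positivity)]
  obtain ⟨m, rfl⟩ := Nat.exists_eq_succ_of_ne_zero hn
  simp only [Nat.succ_eq_add_one, Nat.add_sub_cancel, pow_succ]
  field_simp

variable {n : ℕ} {χ : ℝ → ℝ}

/-- A radial function oscillating on the logarithmic scale, concentrating at the origin as
`k → 0`. -/
noncomputable def logBump (n : ℕ) (χ : ℝ → ℝ) (β k : ℝ) (x : 𝔼 n) : ℝ :=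
  ‖x‖ ^ β * χ (k * Real.log ‖x‖)

lemma tsupport_logBump_subset (hs : tsupport χ ⊆ Set.Icc (-2) (-1)) (β : ℝ) {k : ℝ} (hk : 0 < k) :
    tsupport (logBump n χ β k) ⊆ {x | Real.exp (-2 / k) ≤ ‖x‖ ∧ ‖x‖ ≤ Real.exp (-1 / k)} := by
  refine tsupport_subset_of_forall_notMem ((isClosed_le continuous_const continuous_norm).inter
    (isClosed_le continuous_norm continuous_const)) fun x hx => ?_
  by_contra h
  have h1 : k * Real.log ‖x‖ ∈ tsupport χ := by
    by_contra h2
    exact h (by simp [logBump, image_eq_zero_of_notMem_tsupport h2])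
  obtain ⟨h2, h3⟩ := hs h1
  have hx0 : 0 < ‖x‖ := by
    refine (norm_nonneg x).lt_of_ne fun h4 => ?_
    rw [← h4] at h3
    norm_num at h3
  refine hx ⟨Set.mem_ofPred.2 ?_, Set.mem_ofPred.2 ?_⟩
  · rw [← Real.le_log_iff_exp_le hx0, div_le_iff₀ hk]; linarith
  · rw [← Real.log_le_iff_le_exp hx0, le_div_iff₀ hk]; linarith

lemma tsupport_logBump_subset_ball (hs : tsupport χ ⊆ Set.Icc (-2) (-1)) (β : ℝ) {k : ℝ}
    (hk : 0 < k) : tsupport (logBump n χ β k) ⊆ Metric.ball 0 1 \ {0} := by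
  intro x hx
  obtain ⟨h1, h2⟩ := tsupport_logBump_subset hs β hk hx
  refine ⟨mem_ball_zero_iff.2 (h2.trans_lt ?_), norm_pos_iff.1 ((Real.exp_pos _).trans_le h1)⟩
  rw [Real.exp_lt_one_iff]
  exact div_neg_of_neg_of_pos (by norm_num) hk

lemma hasCompactSupport_logBump (hs : tsupport χ ⊆ Set.Icc (-2) (-1)) (β : ℝ) {k : ℝ}
    (hk : 0 < k) : HasCompactSupport (logBump n χ β k) :=
  (isCompact_closedBall (0 : 𝔼 n) 1).of_isClosed_subset (isClosed_tsupport _) fun _ hx =>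
    Metric.ball_subset_closedBall (tsupport_logBump_subset_ball hs β hk hx).1

lemma contDiff_logBump (hχ : ContDiff ℝ (⊤ : ℕ∞) χ) (hs : tsupport χ ⊆ Set.Icc (-2) (-1)) (β : ℝ)
    {k : ℝ} (hk : 0 < k) : ContDiff ℝ (⊤ : ℕ∞) (logBump n χ β k) := by
  refine contDiff_of_forall_mem_tsupport fun x hx => ?_
  have hx0 : x ≠ 0 := (tsupport_logBump_subset_ball hs β hk hx).2
  have h1 : ContDiffAt ℝ (⊤ : ℕ∞) (fun y : 𝔼 n => ‖y‖) x := contDiffAt_norm ℝ hx0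
  have h2 := norm_ne_zero_iff.2 hx0
  exact (h1.rpow_const_of_ne h2).mul
    (hχ.contDiffAt.comp x (contDiffAt_const.mul (h1.log h2)))

lemma logBump_ne_zero (hn : 0 < n) {v : ℝ} (hv : χ v ≠ 0) (β : ℝ) {k : ℝ} (hk : 0 < k) :
    logBump n χ β k ≠ 0 := by
  intro h
  have h0 := Real.exp_pos (v / k)
  have h1 := congrFun h (EuclideanSpace.single ⟨0, hn⟩ (Real.exp (v / k)))
  simp only [logBump, PiLp.norm_single, Real.norm_eq_abs, abs_of_pos h0, Real.log_exp,
    Pi.zero_apply, mul_div_cancel₀ v hk.ne'] at h1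
  exact (mul_ne_zero (Real.rpow_pos_of_pos h0 β).ne' hv) h1

lemma gradient_logBump (hχ : ContDiff ℝ (⊤ : ℕ∞) χ) (β k : ℝ) {x : 𝔼 n} (hx : x ≠ 0) :
    gradient (logBump n χ β k) x =
      (‖x‖ ^ (β - 2) * logDerivProfile χ β k (k * Real.log ‖x‖)) • x := by
  have h0 := norm_pos_iff.2 hx
  have h := gradient_radial hx (hasDerivAt_rpow_mul_comp_log (β := β) h0
    (hχ.differentiable (by simp) (k * Real.log ‖x‖)).hasDerivAt)
  refine h.trans ?_
  have e : ‖x‖ ^ (β - 2) = ‖x‖ ^ (β - 1) / ‖x‖ := by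
    rw [← Real.rpow_sub_one h0.ne']; ring_nf
  rw [e, logDerivProfile]
  congr 1
  field_simp

lemma dvg_gradient_logBump (hχ : ContDiff ℝ (⊤ : ℕ∞) χ) (β k : ℝ) {x : 𝔼 n}
    (hx : x ∈ Metric.ball (0 : 𝔼 n) 1 \ {0}) :
    dvg (fun y => lam y ^ ((n : ℝ) - 2) • gradient (logBump n χ β k) y) x =
      lam x ^ ((n : ℝ) - 2) * ‖x‖ ^ (β - 2) *
        ((n + β - 2) * logDerivProfile χ β k (k * Real.log ‖x‖) +
          k * logDerivProfile (deriv χ) β k (k * Real.log ‖x‖) +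
          (n - 2) * lam x * ‖x‖ ^ 2 * logDerivProfile χ β k (k * Real.log ‖x‖)) := by
  obtain ⟨h0, h1⟩ := norm_pos_and_lt_one hx
  have hL := confFactor_pos (by linarith) h1
  have hcongr : (fun y => lam y ^ ((n : ℝ) - 2) • gradient (logBump n χ β k) y) =ᶠ[nhds x]
      fun y => (confFactor ‖y‖ ^ ((n : ℝ) - 2) *
        (‖y‖ ^ (β - 2) * logDerivProfile χ β k (k * Real.log ‖y‖))) • y := by
    filter_upwards [isOpen_ne.mem_nhds hx.2] with y hy
    rw [gradient_logBump hχ β k hy, smul_smul, lam_eq]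
  have hg := ((hasDerivAt_confFactor (by linarith) h1).rpow_const (p := (n : ℝ) - 2)
    (Or.inl hL.ne')).mul (hasDerivAt_rpow_mul_comp_log (β := β - 2) h0
      (hasDerivAt_logDerivProfile hχ β k (k * Real.log ‖x‖)))
  rw [dvg_congr hcongr, dvg_radial (g := fun s => confFactor s ^ ((n : ℝ) - 2) *
    (s ^ (β - 2) * logDerivProfile χ β k (k * Real.log s))) hx.2 hg, lam_eq,
    Real.rpow_sub_one hL.ne', Real.rpow_sub_one h0.ne']
  field_simp
  ring

lemma rellich_numerator_integrand_logBump (hχ : ContDiff ℝ (⊤ : ℕ∞) χ) (α k : ℝ) {β : ℝ}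
    (hβ : 2 * β = 4 - n - α) {x : 𝔼 n} (hx : x ∈ Metric.ball (0 : 𝔼 n) 1 \ {0}) :
    dH x ^ α * lam x ^ (-(n : ℝ)) *
        (dvg (fun y => lam y ^ ((n : ℝ) - 2) • gradient (logBump n χ β k) y) x) ^ 2 =
      (‖x‖ ^ n)⁻¹ * numeratorDensity n α β χ (k, ‖x‖, k * Real.log ‖x‖) := by
  obtain ⟨h0, h1⟩ := norm_pos_and_lt_one hx
  have hL := confFactor_pos (by linarith) h1
  have hD := dslope_hypDist_pos h0.le h1
  rw [dvg_gradient_logBump hχ β k hx, dH_eq, lam_eq, hypDist_eq_mul_dslope,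
    Real.mul_rpow h0.le hD.le, numeratorDensity]
  have e1 : confFactor ‖x‖ ^ ((n : ℝ) - 4) =
      confFactor ‖x‖ ^ (-(n : ℝ)) * (confFactor ‖x‖ ^ ((n : ℝ) - 2)) ^ 2 := by
    rw [← Real.rpow_mul_natCast hL.le, ← Real.rpow_add hL]
    congr 1; push_cast; ring
  have e2 : (‖x‖ ^ n)⁻¹ = ‖x‖ ^ α * (‖x‖ ^ (β - 2)) ^ 2 := by
    rw [← Real.rpow_mul_natCast h0.le, ← Real.rpow_add h0, ← Real.rpow_natCast ‖x‖ n,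
      ← Real.rpow_neg h0.le]
    congr 1; push_cast; linarith
  simp only [e1, e2]
  ring

lemma rellich_denominator_integrand_logBump (hχ : ContDiff ℝ (⊤ : ℕ∞) χ) (α k : ℝ) {β : ℝ}
    (hβ : 2 * β = 4 - n - α) {x : 𝔼 n} (hx : x ∈ Metric.ball (0 : 𝔼 n) 1 \ {0}) :
    dH x ^ (α - 2) * ‖gradient (logBump n χ β k) x‖ ^ 2 * lam x ^ ((n : ℝ) - 2) =
      (‖x‖ ^ n)⁻¹ * denominatorDensity n α β χ (k, ‖x‖, k * Real.log ‖x‖) := by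
  obtain ⟨h0, h1⟩ := norm_pos_and_lt_one hx
  have hD := dslope_hypDist_pos h0.le h1
  rw [gradient_logBump hχ β k hx.2, dH_eq, lam_eq, hypDist_eq_mul_dslope,
    Real.mul_rpow h0.le hD.le, denominatorDensity, norm_smul, mul_pow, Real.norm_eq_abs, sq_abs]
  have e2 : (‖x‖ ^ n)⁻¹ = ‖x‖ ^ (α - 2) * (‖x‖ ^ (β - 2)) ^ 2 * ‖x‖ ^ 2 := by
    rw [← Real.rpow_mul_natCast h0.le, ← Real.rpow_add h0, ← Real.rpow_add_natCast h0.ne',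
      ← Real.rpow_natCast ‖x‖ n, ← Real.rpow_neg h0.le]
    congr 1; push_cast; linarith
  simp only [e2]
  ring

/-- Passage to the logarithmic variable for a radial integral over the unit ball. -/
lemma setIntegral_ball_eq_setIntegral_exp [NeZero n] {f : (𝔼 n) → ℝ} {H : ℝ × ℝ × ℝ → ℝ} {k : ℝ}
    (hk : 0 < k) (hf : ∀ x ∈ Metric.ball (0 : 𝔼 n) 1 \ {0},
      f x = (‖x‖ ^ n)⁻¹ * H (k, ‖x‖, k * Real.log ‖x‖))
    (hH : ∀ k s v, v ∉ Set.Icc (-2 : ℝ) (-1) → H (k, s, v) = 0) :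
    ∫ x in Metric.ball (0 : 𝔼 n) 1, f x =
      (n * (volume : Measure (𝔼 n)).real (Metric.ball 0 1) * k⁻¹) *
        ∫ v in Set.Icc (-2 : ℝ) (-1), H (k, Real.exp (v / k), v) := by
  have hn : 0 < n := Nat.pos_of_ne_zero (NeZero.ne n)
  have : Nonempty (Fin n) := ⟨⟨0, hn⟩⟩
  have : Nontrivial (𝔼 n) := inferInstance
  have h1 : ∫ x in Metric.ball (0 : 𝔼 n) 1, f x =
      ∫ x in Metric.ball (0 : 𝔼 n) 1, (‖x‖ ^ n)⁻¹ * H (k, ‖x‖, k * Real.log ‖x‖) := by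
    refine setIntegral_congr_ae Metric.isOpen_ball.measurableSet ?_
    filter_upwards [Measure.ae_ne volume (0 : 𝔼 n)] with x hx hxb using hf x ⟨hxb, hx⟩
  rw [h1, setIntegral_eq_integral_of_forall_compl_eq_zero,
    integral_norm_eq_integral_exp (fun s => H (k, s, k * Real.log s)) hk,
    setIntegral_eq_integral_of_forall_compl_eq_zero fun v hv => hH _ _ v hv]
  · simp only [Real.log_exp, mul_div_cancel₀ _ hk.ne']
  · intro x hx
    rw [hH, mul_zero]
    intro h
    have h2 : 1 ≤ ‖x‖ := by simpa using hx
    have := mul_nonneg hk.le (Real.log_nonneg h2)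
    linarith [h.2]

lemma numeratorDensity_zero_zero (α : ℝ) {β : ℝ} (hβ : 2 * β = 4 - n - α) (v : ℝ) :
    numeratorDensity n α β χ (0, 0, v) =
      ((n : ℝ) - α) ^ 2 / 4 * denominatorDensity n α β χ (0, 0, v) := by
  have e0 : confFactor 0 = 2 := by simp [confFactor]
  have e1 : (2 : ℝ) ^ α * 2 ^ ((n : ℝ) - 4) = 2 ^ (α - 2) * 2 ^ ((n : ℝ) - 2) := by
    rw [← Real.rpow_add two_pos, ← Real.rpow_add two_pos]; ring_nf
  have e2 : (n : ℝ) + β - 2 = (n - α) / 2 := by linarith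
  simp only [numeratorDensity, denominatorDensity, dslope_hypDist_zero, e0, e1, e2]
  ring

lemma setIntegral_denominatorDensity_zero_zero_pos (hχ : ContDiff ℝ (⊤ : ℕ∞) χ)
    (hs : tsupport χ ⊆ Set.Icc (-2) (-1)) {v : ℝ} (hv : χ v ≠ 0) (ν α : ℝ) {β : ℝ} (hβ : β ≠ 0) :
    0 < ∫ v in Set.Icc (-2 : ℝ) (-1), denominatorDensity ν α β χ (0, 0, v) := by
  have e0 : confFactor 0 = 2 := by simp [confFactor]
  rw [setIntegral_eq_integral_of_forall_compl_eq_zero fun v hv => by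
    simp [denominatorDensity, logDerivProfile_eq_zero fun h => hv (hs h)]]
  have hc : HasCompactSupport χ := isCompact_Icc.of_isClosed_subset (isClosed_tsupport _) hs
  have := hχ.continuous
  simp only [denominatorDensity, logDerivProfile, dslope_hypDist_zero, e0, zero_mul, add_zero]
  refine Continuous.integral_pos_of_hasCompactSupport_nonneg_nonzero (x := v) (by fun_prop)
    ?_ (fun y => ?_) (by positivity)
  · exact hc.mono fun y hy h => hy (by simp [h])
  · simp only [Pi.zero_apply]
    positivity

/-- The Rellich quotients of the logarithmic bumps converge to the sharp constant. -/
lemma tendsto_rellich_quotient_logBump [NeZero n] (hχ : ContDiff ℝ (⊤ : ℕ∞) χ)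
    (hs : tsupport χ ⊆ Set.Icc (-2) (-1)) {v : ℝ} (hv : χ v ≠ 0) {α β : ℝ}
    (hβ : 2 * β = 4 - n - α) (hβ0 : β ≠ 0) :
    Filter.Tendsto (fun N : ℕ =>
      (∫ x in Metric.ball (0 : 𝔼 n) 1, dH x ^ α * lam x ^ (-(n : ℝ)) *
        (dvg (fun y => lam y ^ ((n : ℝ) - 2) •
          gradient (logBump n χ β (1 / ((N : ℝ) + 1))) y) x) ^ 2) /
      (∫ x in Metric.ball (0 : 𝔼 n) 1, dH x ^ (α - 2) *
        ‖gradient (logBump n χ β (1 / ((N : ℝ) + 1))) x‖ ^ 2 * lam x ^ ((n : ℝ) - 2)))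
      Filter.atTop (nhds (((n : ℝ) - α) ^ 2 / 4)) := by
  have hpos := setIntegral_denominatorDensity_zero_zero_pos hχ hs hv n α hβ0
  have hlim := (tendsto_setIntegral_exp_of_continuousOn (continuousOn_numeratorDensity hχ n α β)).div
    (tendsto_setIntegral_exp_of_continuousOn (continuousOn_denominatorDensity hχ n α β)) hpos.ne'
  simp only [numeratorDensity_zero_zero α hβ, integral_const_mul] at hlim
  rw [mul_div_cancel_right₀ _ hpos.ne'] at hlim
  refine hlim.congr fun N => ?_
  have hk : (0 : ℝ) < 1 / ((N : ℝ) + 1) := Nat.one_div_pos_of_nat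
  have hdχ (v : ℝ) (hv : v ∉ Set.Icc (-2 : ℝ) (-1)) : v ∉ tsupport (deriv χ) :=
    fun h => hv (hs (tsupport_deriv_subset h))
  rw [setIntegral_ball_eq_setIntegral_exp hk
      (fun x hx => rellich_numerator_integrand_logBump hχ α _ hβ hx)
      (fun k s v hv => by
        simp [numeratorDensity, logDerivProfile_eq_zero fun h => hv (hs h),
          logDerivProfile_eq_zero (hdχ v hv)]),
    setIntegral_ball_eq_setIntegral_exp hk
      (fun x hx => rellich_denominator_integrand_logBump hχ α _ hβ hx)
      (fun k s v hv => by
        simp [denominatorDensity, logDerivProfile_eq_zero fun h => hv (hs h)])]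
  have hball : 0 < (volume : Measure (𝔼 n)).real (Metric.ball 0 1) :=
    ENNReal.toReal_pos (Metric.measure_ball_pos volume _ one_pos).ne' measure_ball_lt_top.ne
  have hn : (0 : ℝ) < n := by exact_mod_cast Nat.pos_of_ne_zero (NeZero.ne n)
  exact (mul_div_mul_left _ _ (by positivity)).symm

end TestFunctions

/-- Sharpness of the constant in the Rellich-type inequality on ℍⁿ (Theorem 3.2). -/
theorem weighted_rellich_hyperbolic_sharp {n : ℕ} (hn : 2 < n)
    (α : ℝ) (hα₁ : (8 - (n : ℝ)) / 3 < α) (hα₂ : α < 2) :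
    sInf { r : ℝ | ∃ φ : EuclideanSpace ℝ (Fin n) → ℝ,
        ContDiff ℝ (⊤ : ℕ∞) φ ∧ HasCompactSupport φ ∧
        tsupport φ ⊆ Metric.ball (0 : EuclideanSpace ℝ (Fin n)) 1 \ {0} ∧ φ ≠ 0 ∧
        r = (∫ x in Metric.ball (0 : EuclideanSpace ℝ (Fin n)) 1,
              dH x ^ α * lam x ^ (-(n : ℝ)) *
                (dvg (fun y => lam y ^ ((n : ℝ) - 2) • gradient φ y) x) ^ 2) /
            (∫ x in Metric.ball (0 : EuclideanSpace ℝ (Fin n)) 1,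
              dH x ^ (α - 2) * ‖gradient φ x‖ ^ 2 * lam x ^ ((n : ℝ) - 2)) } =
      ((n : ℝ) - α) ^ 2 / 4 := by
  have hn' : (2 : ℝ) < n := by exact_mod_cast hn
  have : NeZero n := ⟨by omega⟩
  let χ : ContDiffBump (-3 / 2 : ℝ) := ⟨1 / 4, 1 / 2, by norm_num, by norm_num⟩
  have hχ : ContDiff ℝ (⊤ : ℕ∞) χ := χ.contDiff
  have hs : tsupport χ ⊆ Set.Icc (-2) (-1) := by
    rw [χ.tsupport_eq, Real.closedBall_eq_Icc]
    exact Set.Icc_subset_Icc (by norm_num [χ]) (by norm_num [χ])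
  have hv : χ (-3 / 2) ≠ 0 := (χ.pos_of_mem_ball (Metric.mem_ball_self χ.rOut_pos)).ne'
  have hβ : 2 * ((4 - n - α) / 2) = 4 - n - α := by ring
  have hβ0 : (4 - n - α) / 2 ≠ 0 := by
    have : (4 - n - α) / 2 < 0 := by linarith
    exact this.ne
  refine IsGLB.csInf_eq ⟨?_, fun b hb => ?_⟩ ?_
  · rintro r ⟨φ, hφ, hc, hs, h0, rfl⟩
    rw [le_div_iff₀ (rellich_denominator_pos hφ hc hs h0 α)]
    exact weighted_rellich_hyperbolic hn hα₁ hα₂ hφ hc hs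
  · refine ge_of_tendsto' (tendsto_rellich_quotient_logBump hχ hs hv hβ hβ0) fun N => hb ?_
    have hk : (0 : ℝ) < 1 / ((N : ℝ) + 1) := Nat.one_div_pos_of_nat
    exact ⟨_, contDiff_logBump hχ hs _ hk, hasCompactSupport_logBump hs _ hk,
      tsupport_logBump_subset_ball hs _ hk, logBump_ne_zero (by omega) hv _ hk, rfl⟩
  · exact ⟨_, _, contDiff_logBump hχ hs 0 one_pos, hasCompactSupport_logBump hs 0 one_pos,
      tsupport_logBump_subset_ball hs 0 one_pos, logBump_ne_zero (by omega) hv 0 one_pos, rfl⟩
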